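/- Let R be a TRS over a signature Σ and P a non-collapsing TRS over an extension of Σ such that R ∪ P is a right-linear overlay system. Then there exists no infinite minimal (P,R)-chain if and only if there exists no infinite innermost minimal (P,R)-chain. -/

import Mathlib

namespace RWS

/-- First-order terms over a signature `F` (function symbols of arbitrary arity,
realized by lists of arguments) and variables `V`. -/
inductive Term (F V : Type) : Type
  | var : V → Term F V
  | app : F → List (Term F V) → Term F V

namespace Term

variable {F V : Type}

/-- `t` is a variable. -/
def IsVar : Term F V → Prop
  | var _ => True
  | app _ _ => False

/-- Application of a substitution (a map from variables to terms) to a term. -/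
def subst (σ : V → Term F V) : Term F V → Term F V
  | var x => σ x
  | app f ts => app f (ts.attach.map fun t => t.1.subst σ)
decreasing_by
  simp_wf
  have := List.sizeOf_lt_of_mem t.2
  omega

/-- The list of variable occurrences of a term. -/
def varOccs : Term F V → List V
  | var x => [x]
  | app _ ts => (ts.attach.map fun t => t.1.varOccs).flatten
decreasing_by
  simp_wf
  have := List.sizeOf_lt_of_mem t.2
  omega

/-- A term is linear if no variable occurs in it more than once. -/
def Linear (t : Term F V) : Prop := t.varOccs.Nodup

end Term

variable {F V : Type}

/-- `PSub t u` : `t` is a proper subterm of `u` (i.e. `u ▷ t`). -/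
inductive PSub : Term F V → Term F V → Prop
  | head {t f ts} : t ∈ ts → PSub t (.app f ts)
  | tail {t u f ts} : PSub t u → u ∈ ts → PSub t (.app f ts)

/-- Subterm-or-equal relation. -/
def Sub (t u : Term F V) : Prop := t = u ∨ PSub t u

/-- The rewrite relation of a set `R` of rewrite rules: contraction of a redex
at some position (root rule instance, closed under contexts). -/
inductive Rew (R : Set (Term F V × Term F V)) : Term F V → Term F V → Prop
  | root {l r : Term F V} {σ : V → Term F V} :
      (l, r) ∈ R → Rew R (l.subst σ) (r.subst σ)
  | congr {s t : Term F V} {f : F} {ts us : List (Term F V)} :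
      Rew R s t → Rew R (.app f (ts ++ s :: us)) (.app f (ts ++ t :: us))

/-- `t` is a normal form of `R`. -/
def NormalForm (R : Set (Term F V × Term F V)) (t : Term F V) : Prop :=
  ∀ u, ¬ Rew R t u

/-- Innermost rewriting: contraction of a redex all of whose proper subterms
are normal forms of `R`. -/
inductive IRew (R : Set (Term F V × Term F V)) : Term F V → Term F V → Prop
  | root {l r : Term F V} {σ : V → Term F V} :
      (l, r) ∈ R → (∀ u, PSub u (l.subst σ) → NormalForm R u) →
      IRew R (l.subst σ) (r.subst σ)
  | congr {s t : Term F V} {f : F} {ts us : List (Term F V)} :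
      IRew R s t → IRew R (.app f (ts ++ s :: us)) (.app f (ts ++ t :: us))

/-- A rewrite step at the root position (`→_{ε}`). -/
def RootStep (R : Set (Term F V × Term F V)) (s t : Term F V) : Prop :=
  ∃ l r σ, (l, r) ∈ R ∧ s = Term.subst σ l ∧ t = Term.subst σ r

/-- A rewrite step strictly below the root (`→_{>ε}`). -/
def BelowRew (R : Set (Term F V × Term F V)) (s t : Term F V) : Prop :=
  ∃ (f : F) (ts us : List (Term F V)) (a b : Term F V),
    Rew R a b ∧ s = .app f (ts ++ a :: us) ∧ t = .app f (ts ++ b :: us)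

/-- An innermost rewrite step strictly below the root (`i→_{>ε}`). -/
def IBelowRew (R : Set (Term F V × Term F V)) (s t : Term F V) : Prop :=
  ∃ (f : F) (ts us : List (Term F V)) (a b : Term F V),
    IRew R a b ∧ s = .app f (ts ++ a :: us) ∧ t = .app f (ts ++ b :: us)

/-- `R` is a term rewrite system: left-hand sides are not variables and
variables of right-hand sides occur in the corresponding left-hand sides. -/
def IsTRS (R : Set (Term F V × Term F V)) : Prop :=
  ∀ p ∈ R, ¬ p.1.IsVar ∧ ∀ x ∈ p.2.varOccs, x ∈ p.1.varOccs

/-- All right-hand sides are linear. -/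
def RightLinear (R : Set (Term F V × Term F V)) : Prop :=
  ∀ p ∈ R, p.2.Linear

/-- No right-hand side is a variable. -/
def NonCollapsing (R : Set (Term F V × Term F V)) : Prop :=
  ∀ p ∈ R, ¬ p.2.IsVar

/-- `R` has an inner-overlap: a proper non-variable subterm of some left-hand
side is unifiable (after renaming the rules apart, equivalently: some instance
of the one equals some instance of the other) with some left-hand side. -/
def InnerOverlap (R : Set (Term F V × Term F V)) : Prop :=
  ∃ l r l' r' u, (l, r) ∈ R ∧ (l', r') ∈ R ∧ PSub u l ∧ ¬ u.IsVar ∧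
    ∃ σ τ : V → Term F V, u.subst σ = l'.subst τ

/-- `R` is an overlay system. -/
def Overlay (R : Set (Term F V × Term F V)) : Prop := ¬ InnerOverlap R

/-- The term `t` is terminating w.r.t. `R`: no infinite rewrite sequence starts from `t`. -/
def Terminating (R : Set (Term F V × Term F V)) (t : Term F V) : Prop :=
  ¬ ∃ f : ℕ → Term F V, f 0 = t ∧ ∀ n, Rew R (f n) (f (n + 1))

/-- The TRS `R` is terminating: there is no infinite rewrite sequence. -/
def TerminatingTRS (R : Set (Term F V × Term F V)) : Prop :=
  ¬ ∃ f : ℕ → Term F V, ∀ n, Rew R (f n) (f (n + 1))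

/-- The TRS `R` is innermost terminating: there is no infinite innermost rewrite sequence. -/
def InnermostTerminatingTRS (R : Set (Term F V × Term F V)) : Prop :=
  ¬ ∃ f : ℕ → Term F V, ∀ n, IRew R (f n) (f (n + 1))

/-- Domain of a substitution. -/
def Dom (σ : V → Term F V) : Set V := {x | σ x ≠ .var x}

end RWS

namespace RWS

variable {F V : Type}

/-- Embedding of terms over the signature `F` into terms over the extended
signature `F ⊕ F`, where `Sum.inl f` is the original symbol `f` and
`Sum.inr f` is the fresh tuple symbol `f#`. -/
def Term.lift : Term F V → Term (F ⊕ F) V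
  | .var x => .var x
  | .app f ts => .app (Sum.inl f) (ts.attach.map fun t => t.1.lift)
decreasing_by
  simp_wf
  have := List.sizeOf_lt_of_mem t.2
  omega

/-- The TRS `R` viewed over the extended signature `F ⊕ F`. -/
def liftTRS (R : Set (Term F V × Term F V)) :
    Set (Term (F ⊕ F) V × Term (F ⊕ F) V) :=
  { p | ∃ l r, (l, r) ∈ R ∧ p = (l.lift, r.lift) }

/-- The defined symbols of `R`: root symbols of left-hand sides. -/
def DefinedSym (R : Set (Term F V × Term F V)) : Set F :=
  { f | ∃ ts r, (Term.app f ts, r) ∈ R }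

/-- `t#`: the term `f(t₁,…,tₙ)` with its root replaced by the tuple symbol `f#`. -/
def Term.sharp : Term F V → Term (F ⊕ F) V
  | .var x => .var x
  | .app f ts => .app (Sum.inr f) (ts.attach.map fun t => t.1.lift)

/-- The set of dependency pairs of `R`: rules `ℓ# → t#` where `ℓ → r ∈ R` and
`t` is a subterm of `r` whose root symbol is defined. -/
def DP (R : Set (Term F V × Term F V)) :
    Set (Term (F ⊕ F) V × Term (F ⊕ F) V) :=
  { p | ∃ l r t, (l, r) ∈ R ∧ Sub t r ∧
        (∃ g ts, t = Term.app g ts ∧ g ∈ DefinedSym R) ∧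
        p = (l.sharp, t.sharp) }

/-- There is an infinite minimal `(P,R)`-chain
`t₀ →_{>ε,R}* s₀ →_{ε,P} t₁ →_{>ε,R}* s₁ →_{ε,P} t₂ ⋯` (all proper subterms of
the `tᵢ` are terminating w.r.t. `R`). -/
def InfMinChain (P R : Set (Term F V × Term F V)) : Prop :=
  ∃ t s : ℕ → Term F V,
    (∀ i, Relation.ReflTransGen (BelowRew R) (t i) (s i)) ∧
    (∀ i, RootStep P (s i) (t (i + 1))) ∧
    (∀ i v, PSub v (t i) → Terminating R v)

/-- There is an infinite innermost minimal `(P,R)`-chain: as above, where the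
below-root `R`-steps are innermost and each root `P`-step is applied to a term
all of whose proper subterms are normal forms of `R`. -/
def InfInnMinChain (P R : Set (Term F V × Term F V)) : Prop :=
  ∃ t s : ℕ → Term F V,
    (∀ i, Relation.ReflTransGen (IBelowRew R) (t i) (s i)) ∧
    (∀ i v, PSub v (s i) → NormalForm R v) ∧
    (∀ i, RootStep P (s i) (t (i + 1))) ∧
    (∀ i v, PSub v (t i) → Terminating R v)

/-- Finite minimal `(P,R)`-chains of length `n` (number of root `P`-steps),
from the first term to the term reached right after the `n`-th root `P`-step. -/
inductive MinChainN (P R : Set (Term F V × Term F V)) :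
    ℕ → Term F V → Term F V → Prop
  | refl {t : Term F V} :
      (∀ v, PSub v t → Terminating R v) → MinChainN P R 0 t t
  | step {n : ℕ} {t₀ t s t' : Term F V} :
      MinChainN P R n t₀ t →
      Relation.ReflTransGen (BelowRew R) t s →
      RootStep P s t' →
      (∀ v, PSub v t' → Terminating R v) →
      MinChainN P R (n + 1) t₀ t'

/-- Finite innermost minimal `(P,R)`-chains of length `n`. -/
inductive InnMinChainN (P R : Set (Term F V × Term F V)) :
    ℕ → Term F V → Term F V → Prop
  | refl {t : Term F V} :
      (∀ v, PSub v t → Terminating R v) → InnMinChainN P R 0 t t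
  | step {n : ℕ} {t₀ t s t' : Term F V} :
      InnMinChainN P R n t₀ t →
      Relation.ReflTransGen (IBelowRew R) t s →
      (∀ v, PSub v s → NormalForm R v) →
      RootStep P s t' →
      (∀ v, PSub v t' → Terminating R v) →
      InnMinChainN P R (n + 1) t₀ t'

end RWS

namespace RWS

open Relation List

variable {F V : Type}

/-! ### Terms, substitutions, subterms -/

namespace Term

theorem subst_var (σ : V → Term F V) (x : V) : (var x : Term F V).subst σ = σ x := by
  rw [subst]

theorem subst_app (σ : V → Term F V) (f : F) (ts : List (Term F V)) :
    (app f ts).subst σ = app f (ts.map (subst σ)) := by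
  rw [subst, List.attach_map_val (l := ts) (f := subst σ)]

theorem mem_varOccs_var {x y : V} : x ∈ (var y : Term F V).varOccs ↔ x = y := by
  rw [varOccs, List.mem_singleton]

theorem varOccs_app (f : F) (ts : List (Term F V)) :
    (app f ts).varOccs = ts.flatMap varOccs := by
  rw [varOccs, List.attach_map_val (l := ts) (f := varOccs), List.flatMap_def]

theorem ind {p : Term F V → Prop} (hvar : ∀ x, p (var x))
    (happ : ∀ f ts, (∀ t ∈ ts, p t) → p (app f ts)) (t : Term F V) : p t :=
  Term.rec (motive_2 := fun ts => ∀ t ∈ ts, p t) hvar happ (by simp)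
    (fun _ _ h hs => by simpa using ⟨h, hs⟩) t

theorem exists_eq_app {t : Term F V} (h : ¬ t.IsVar) : ∃ f ts, t = app f ts := by
  cases t with
  | var x => exact absurd trivial h
  | app f ts => exact ⟨f, ts, rfl⟩

theorem subst_congr {σ τ : V → Term F V} (t : Term F V) :
    (∀ x ∈ t.varOccs, σ x = τ x) → t.subst σ = t.subst τ := by
  induction t using ind with
  | hvar x => simp [subst_var, mem_varOccs_var]
  | happ f ts ih =>
    intro h
    rw [subst_app, subst_app]
    congr 1
    refine List.map_congr_left fun t ht => ih t ht fun x hx => h x ?_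
    rw [varOccs_app]
    exact List.mem_flatMap.2 ⟨t, ht, hx⟩

end Term

open Term

/-! ### Closure of many-step rewriting under contexts -/

section Context

variable {R : Set (Term F V × Term F V)}

theorem BelowRew.of_append {f : F} {a b : Term F V} (h : Rew R a b) (ts us : List (Term F V)) :
    BelowRew R (app f (ts ++ a :: us)) (app f (ts ++ b :: us)) :=
  ⟨f, ts, us, a, b, h, rfl, rfl⟩

theorem BelowRew.rew {s t : Term F V} (h : BelowRew R s t) : Rew R s t := by
  obtain ⟨f, ts, us, a, b, h, rfl, rfl⟩ := h
  exact .congr h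

theorem IRew.rew {s t : Term F V} (h : IRew R s t) : Rew R s t := by
  induction h with
  | root h _ => exact .root h
  | congr _ ih => exact .congr ih

theorem IBelowRew.belowRew {s t : Term F V} (h : IBelowRew R s t) : BelowRew R s t := by
  obtain ⟨f, ts, us, a, b, h, rfl, rfl⟩ := h
  exact ⟨f, ts, us, a, b, h.rew, rfl, rfl⟩

/-- A relation closed under one-argument contexts lifts, in its many-step form, to
argument lists. -/
theorem reflTransGen_app_of_forall₂ {r q : Term F V → Term F V → Prop} {f : F}
    (hrq : ∀ {a b} (ts us : List (Term F V)), r a b →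
      q (app f (ts ++ a :: us)) (app f (ts ++ b :: us)))
    {ts us : List (Term F V)} (h : Forall₂ (ReflTransGen r) ts us) :
    ReflTransGen q (app f ts) (app f us) := by
  suffices ∀ ps : List (Term F V), ReflTransGen q (app f (ps ++ ts)) (app f (ps ++ us)) from
    this []
  induction h with
  | nil => exact fun _ => .refl
  | @cons a b ts us hab _ ih =>
    intro ps
    refine .trans (b := app f (ps ++ b :: ts)) ?_ (by simpa using ih (ps ++ [b]))
    clear ih
    induction hab with
    | refl => exact .refl
    | tail _ h ih => exact ih.tail (hrq _ _ h)

theorem belowRews_of_forall₂ {f : F} {ts us : List (Term F V)}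
    (h : Forall₂ (ReflTransGen (Rew R)) ts us) :
    ReflTransGen (BelowRew R) (app f ts) (app f us) :=
  reflTransGen_app_of_forall₂ (fun _ _ h => ⟨f, _, _, _, _, h, rfl, rfl⟩) h

theorem iBelowRews_of_forall₂ {f : F} {ts us : List (Term F V)}
    (h : Forall₂ (ReflTransGen (IRew R)) ts us) :
    ReflTransGen (IBelowRew R) (app f ts) (app f us) :=
  reflTransGen_app_of_forall₂ (fun _ _ h => ⟨f, _, _, _, _, h, rfl, rfl⟩) h

theorem rews_of_forall₂ {f : F} {ts us : List (Term F V)}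
    (h : Forall₂ (ReflTransGen (Rew R)) ts us) :
    ReflTransGen (Rew R) (app f ts) (app f us) :=
  reflTransGen_app_of_forall₂ (fun _ _ h => .congr h) h

theorem iRews_of_forall₂ {f : F} {ts us : List (Term F V)}
    (h : Forall₂ (ReflTransGen (IRew R)) ts us) :
    ReflTransGen (IRew R) (app f ts) (app f us) :=
  reflTransGen_app_of_forall₂ (fun _ _ h => .congr h) h

theorem forall₂_refl {α : Type*} {r : α → α → Prop} (ts : List α) :
    Forall₂ (ReflTransGen r) ts ts :=
  List.forall₂_refl _

theorem forall₂_trans {α : Type*} {r : α → α → Prop} {ts us vs : List α}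
    (h : Forall₂ (ReflTransGen r) ts us) (h' : Forall₂ (ReflTransGen r) us vs) :
    Forall₂ (ReflTransGen r) ts vs := by
  induction h generalizing vs with
  | nil => exact h'
  | cons hab _ ih =>
    cases h' with
    | cons hbc h' => exact .cons (hab.trans hbc) (ih h')

theorem forall₂_append_cons {α : Type*} {r : α → α → Prop} {a b : α}
    (h : r a b) (ts us : List α) :
    Forall₂ (ReflTransGen r) (ts ++ a :: us) (ts ++ b :: us) :=
  List.rel_append (forall₂_refl ts) (.cons (.single h) (forall₂_refl us))

theorem forall₂_of_belowRews {f : F} {ts : List (Term F V)} {s : Term F V}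
    (h : ReflTransGen (BelowRew R) (app f ts) s) :
    ∃ us, s = app f us ∧ Forall₂ (ReflTransGen (Rew R)) ts us := by
  induction h with
  | refl => exact ⟨ts, rfl, forall₂_refl ts⟩
  | tail _ h ih =>
    obtain ⟨us, rfl, hus⟩ := ih
    obtain ⟨g, ps, qs, a, b, hab, he, rfl⟩ := h
    cases he
    exact ⟨_, rfl, forall₂_trans hus (forall₂_append_cons hab _ _)⟩

/-- Substitutions related pointwise on the variables of `t` give related instances of `t`. -/
theorem rel_subst {r : Term F V → Term F V → Prop}
    (happ : ∀ f {ts us : List (Term F V)}, Forall₂ r ts us → r (app f ts) (app f us))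
    {σ τ : V → Term F V} (t : Term F V) :
    (∀ x ∈ t.varOccs, r (σ x) (τ x)) → r (t.subst σ) (t.subst τ) := by
  induction t using Term.ind with
  | hvar x => simp [subst_var, mem_varOccs_var]
  | happ f ts ih =>
    intro h
    rw [subst_app, subst_app]
    refine happ f ?_
    rw [List.forall₂_map_left_iff, List.forall₂_map_right_iff, List.forall₂_same]
    refine fun t ht => ih t ht fun x hx => h x ?_
    rw [varOccs_app]
    exact List.mem_flatMap.2 ⟨t, ht, hx⟩

theorem rews_subst {σ τ : V → Term F V} (t : Term F V)
    (h : ∀ x, ReflTransGen (Rew R) (σ x) (τ x)) :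
    ReflTransGen (Rew R) (t.subst σ) (t.subst τ) :=
  rel_subst (fun _ _ _ => rews_of_forall₂) t fun x _ => h x

theorem rews_subst_map {σ τ : V → Term F V} (ts : List (Term F V))
    (h : ∀ x, ReflTransGen (Rew R) (σ x) (τ x)) :
    Forall₂ (ReflTransGen (Rew R)) (ts.map (subst σ)) (ts.map (subst τ)) := by
  rw [List.forall₂_map_left_iff, List.forall₂_map_right_iff, List.forall₂_same]
  exact fun t _ => rews_subst t h

theorem rews_update [DecidableEq V] {ρ : V → Term F V} {y : V} {v : Term F V}
    (h : ReflTransGen (Rew R) (ρ y) v) (x : V) :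
    ReflTransGen (Rew R) (ρ x) (Function.update ρ y v x) := by
  by_cases hx : x = y
  · subst hx
    simpa using h
  · simpa [hx] using ReflTransGen.refl

end Context

/-! ### Normal forms -/

section NormalForm

variable {R : Set (Term F V × Term F V)}

theorem not_rew_var (hR : IsTRS R) {x : V} {u : Term F V} : ¬ Rew R (var x) u := by
  intro h
  generalize hs : (var x : Term F V) = s at h
  cases h with
  | @root l r σ h =>
    obtain ⟨f, ts, rfl⟩ := exists_eq_app (hR _ h).1
    rw [subst_app] at hs
    cases hs
  | congr _ => cases hs

theorem normalForm_app {f : F} {ts : List (Term F V)} (hts : ∀ t ∈ ts, NormalForm R t)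
    (hroot : ∀ l r τ, (l, r) ∈ R → app f ts ≠ l.subst τ) : NormalForm R (app f ts) := by
  intro u h
  generalize hs : app f ts = s at h
  cases h with
  | root h => exact hroot _ _ _ h hs
  | congr h =>
    cases hs
    exact hts _ (by simp) _ h

theorem NormalForm.arg {f : F} {ts : List (Term F V)} (h : NormalForm R (app f ts))
    {t : Term F V} (ht : t ∈ ts) : NormalForm R t := by
  obtain ⟨ps, qs, rfl⟩ := List.append_of_mem ht
  exact fun u hu => h _ (.congr hu)

theorem NormalForm.pSub {s t : Term F V} (hst : PSub s t) (h : NormalForm R t) :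
    NormalForm R s := by
  induction hst with
  | head ht => exact h.arg ht
  | tail _ ht ih => exact ih (h.arg ht)

theorem NormalForm.eq_of_rews {s t : Term F V} (h : NormalForm R s)
    (hst : ReflTransGen (Rew R) s t) : s = t := by
  rcases hst.cases_head with rfl | ⟨u, hu, _⟩
  · rfl
  · exact absurd hu (h u)

theorem normalForm_of_pSub_app {f : F} {ts : List (Term F V)} (h : ∀ t ∈ ts, NormalForm R t)
    {v : Term F V} (hv : PSub v (app f ts)) : NormalForm R v := by
  cases hv with
  | head hv => exact h _ hv
  | tail hv hu => exact (h _ hu).pSub hv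

/-- Every reducible term has an innermost step. -/
theorem exists_iRew {s t : Term F V} (h : Rew R s t) : ∃ u, IRew R s u := by
  induction s using Term.ind generalizing t with
  | hvar x =>
    generalize hs : (var x : Term F V) = s at h
    cases h with
    | root h =>
      refine ⟨_, .root h fun u hu => ?_⟩
      rw [← hs] at hu
      cases hu
    | congr _ => cases hs
  | happ f ts ih =>
    by_cases hts : ∀ a ∈ ts, NormalForm R a
    · generalize hs : app f ts = s at h
      cases h with
      | root h =>
        refine ⟨_, .root h fun u hu => ?_⟩
        rw [← hs] at hu
        exact normalForm_of_pSub_app hts hu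
      | congr h =>
        cases hs
        exact absurd h (hts _ (by simp) _)
    · simp only [NormalForm] at hts
      push Not at hts
      obtain ⟨a, ha, b, hab⟩ := hts
      obtain ⟨u, hu⟩ := ih a ha hab
      obtain ⟨ps, qs, rfl⟩ := List.append_of_mem ha
      exact ⟨_, .congr hu⟩

/-- No instance of a non-variable subterm of `u` is a redex of `R`. -/
def NoRedexInstance (R : Set (Term F V × Term F V)) (u : Term F V) : Prop :=
  ∀ u', Sub u' u → ¬ u'.IsVar → ∀ σ l r τ, (l, r) ∈ R → u'.subst σ ≠ l.subst τ

theorem NoRedexInstance.arg {f : F} {us : List (Term F V)}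
    (h : NoRedexInstance R (app f us)) {u : Term F V} (hu : u ∈ us) : NoRedexInstance R u := by
  rintro u' (rfl | hu')
  · exact h _ (.inr (.head hu))
  · exact h _ (.inr (.tail hu' hu))

theorem NoRedexInstance.normalForm_subst {σ : V → Term F V} {u : Term F V}
    (h : NoRedexInstance R u) (hσ : ∀ x ∈ u.varOccs, NormalForm R (σ x)) :
    NormalForm R (u.subst σ) := by
  induction u using Term.ind with
  | hvar x => simpa [subst_var, mem_varOccs_var] using hσ
  | happ f us ih =>
    have hroot := h _ (.inl rfl) (fun h => h) σ
    rw [subst_app] at hroot ⊢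
    refine normalForm_app (fun t ht => ?_) hroot
    obtain ⟨u, hu, rfl⟩ := List.mem_map.1 ht
    refine ih u hu (h.arg hu) fun x hx => hσ x ?_
    rw [varOccs_app]
    exact List.mem_flatMap.2 ⟨u, hu, hx⟩

theorem Overlay.noRedexInstance {P : Set (Term F V × Term F V)} (h : Overlay (R ∪ P))
    {f : F} {ls : List (Term F V)} {r : Term F V} (hl : (app f ls, r) ∈ R ∪ P)
    {u : Term F V} (hu : u ∈ ls) : NoRedexInstance R u := by
  rintro u' hu' hvar σ l' r' τ hl' he
  refine h ⟨_, _, _, _, u', hl, .inl hl', ?_, hvar, σ, τ, he⟩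
  rcases hu' with rfl | hu'
  · exact .head hu
  · exact .tail hu' hu

end NormalForm

/-! ### Termination -/

section Termination

variable {R : Set (Term F V × Term F V)}

/-- All arguments of `t` are terminating. -/
def ArgsTerminating (R : Set (Term F V × Term F V)) (t : Term F V) : Prop :=
  ∀ f ts, t = app f ts → ∀ a ∈ ts, Terminating R a

theorem Terminating.of_rew {s t : Term F V} (h : Terminating R s) (hst : Rew R s t) :
    Terminating R t := by
  rintro ⟨g, rfl, hg⟩
  refine h ⟨fun n => n.casesOn s g, rfl, ?_⟩
  rintro (_ | n)
  · exact hst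
  · exact hg n

theorem Terminating.of_rews {s t : Term F V} (h : Terminating R s)
    (hst : ReflTransGen (Rew R) s t) : Terminating R t := by
  induction hst with
  | refl => exact h
  | tail _ h' ih => exact ih.of_rew h'

theorem Terminating.arg {f : F} {ts : List (Term F V)} (h : Terminating R (app f ts))
    {t : Term F V} (ht : t ∈ ts) : Terminating R t := by
  obtain ⟨ps, qs, rfl⟩ := List.append_of_mem ht
  rintro ⟨g, rfl, hg⟩
  exact h ⟨fun n => app f (ps ++ g n :: qs), rfl, fun n => .congr (hg n)⟩

theorem Terminating.pSub {s t : Term F V} (hst : PSub s t) (h : Terminating R t) :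
    Terminating R s := by
  induction hst with
  | head ht => exact h.arg ht
  | tail _ ht ih => exact ih (h.arg ht)

theorem argsTerminating_app {f : F} {ts : List (Term F V)} :
    ArgsTerminating R (app f ts) ↔ ∀ a ∈ ts, Terminating R a :=
  ⟨fun h => h f ts rfl, fun h => by rintro _ _ ⟨⟩; exact h⟩

theorem argsTerminating_iff {t : Term F V} :
    ArgsTerminating R t ↔ ∀ v, PSub v t → Terminating R v := by
  constructor
  · intro h v hv
    cases hv with
    | head hv => exact h _ _ rfl _ hv
    | tail hv hu => exact (h _ _ rfl _ hu).pSub hv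
  · rintro h f ts rfl a ha
    exact h a (.head ha)

theorem terminating_of_forall₂ {ts us : List (Term F V)}
    (h : Forall₂ (ReflTransGen (Rew R)) ts us) (hts : ∀ t ∈ ts, Terminating R t) :
    ∀ u ∈ us, Terminating R u := by
  induction h with
  | nil => simp
  | cons hab _ ih =>
    rw [List.forall_mem_cons] at hts ⊢
    exact ⟨hts.1.of_rews hab, ih hts.2⟩

theorem ArgsTerminating.of_belowRews {s t : Term F V} (h : ArgsTerminating R s)
    (hst : ReflTransGen (BelowRew R) s t) : ArgsTerminating R t := by
  cases s with
  | var x =>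
    rcases hst.cases_head with rfl | ⟨u, ⟨f, ts, us, a, b, _, he, _⟩, _⟩
    · exact h
    · cases he
  | app f ts =>
    obtain ⟨us, rfl, hus⟩ := forall₂_of_belowRews hst
    rw [argsTerminating_app] at h ⊢
    exact terminating_of_forall₂ hus h

theorem Terminating.subst_var_mem {σ : V → Term F V} {u : Term F V}
    (h : Terminating R (u.subst σ)) {x : V} (hx : x ∈ u.varOccs) : Terminating R (σ x) := by
  induction u using Term.ind with
  | hvar y => simpa [mem_varOccs_var.1 hx, subst_var] using h
  | happ f us ih =>
    rw [varOccs_app] at hx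
    obtain ⟨u, hu, hx⟩ := List.mem_flatMap.1 hx
    rw [subst_app] at h
    exact ih u hu (h.arg (List.mem_map_of_mem hu)) hx

theorem Terminating.acc {t : Term F V} (h : Terminating R t) : Acc (flip (Rew R)) t := by
  by_contra hacc
  obtain ⟨g, h0, hg⟩ := not_acc_iff_exists_descending_chain.1 hacc
  exact h ⟨g, h0, hg⟩

/-- One-step rewriting in one entry of a list of terms. -/
inductive ListRew (R : Set (Term F V × Term F V)) :
    List (Term F V) → List (Term F V) → Prop
  | head {a b ts} : Rew R a b → ListRew R (a :: ts) (b :: ts)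
  | tail {a ts us} : ListRew R ts us → ListRew R (a :: ts) (a :: us)

theorem ListRew.exists_append {ts us : List (Term F V)} (h : ListRew R ts us) :
    ∃ ps qs a b, Rew R a b ∧ ts = ps ++ a :: qs ∧ us = ps ++ b :: qs := by
  induction h with
  | head h => exact ⟨[], _, _, _, h, rfl, rfl⟩
  | @tail c _ _ _ ih =>
    obtain ⟨ps, qs, a, b, h, rfl, rfl⟩ := ih
    exact ⟨c :: ps, qs, a, b, h, rfl, rfl⟩

theorem ListRew.belowRew {ts us : List (Term F V)} (h : ListRew R ts us) (f : F) :
    BelowRew R (app f ts) (app f us) := by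
  obtain ⟨ps, qs, a, b, hab, rfl, rfl⟩ := h.exists_append
  exact .of_append hab ps qs

theorem acc_listRew {ts : List (Term F V)} (h : ∀ t ∈ ts, Acc (flip (Rew R)) t) :
    Acc (flip (ListRew R)) ts := by
  induction ts with
  | nil => exact ⟨_, fun _ h => nomatch h⟩
  | cons t ts ih =>
    rw [List.forall_mem_cons] at h
    have hts := ih h.2
    have ht := h.1
    clear ih h
    induction ht generalizing ts with
    | intro t _ iht =>
      induction hts with
      | intro ts hacc ihts =>
        refine ⟨_, fun us hus => ?_⟩
        cases hus with
        | head h => exact iht _ h _ ⟨_, hacc⟩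
        | tail h => exact ihts _ h

theorem exists_iRews_normalForm (R : Set (Term F V × Term F V)) (t : Term F V) :
    ∃ u, ReflTransGen (IRew R) t u ∧ (Terminating R t → NormalForm R u) := by
  by_cases ht : Terminating R t
  · suffices ∃ u, ReflTransGen (IRew R) t u ∧ NormalForm R u by
      obtain ⟨u, h, hu⟩ := this
      exact ⟨u, h, fun _ => hu⟩
    have hacc := ht.acc
    clear ht
    induction hacc with
    | intro t _ ih =>
      by_cases hn : NormalForm R t
      · exact ⟨t, .refl, hn⟩
      · simp only [NormalForm] at hn
        push Not at hn
        obtain ⟨u, hu⟩ := hn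
        obtain ⟨v, hv⟩ := exists_iRew hu
        obtain ⟨w, hvw, hw⟩ := ih v hv.rew
        exact ⟨w, .head hv hvw, hw⟩
  · exact ⟨t, .refl, fun h => absurd h ht⟩

end Termination

/-! ### Many-step rewriting to a normal form can be made innermost -/

section Innermost

variable {R P : Set (Term F V × Term F V)}

theorem exists_iRews_args {f : F} {ts : List (Term F V)} {u : Term F V}
    (h : ReflTransGen (IRew R) (app f ts) u) (hu : NormalForm R u) :
    ∃ ts', Forall₂ (ReflTransGen (IRew R)) ts ts' ∧ (∀ t ∈ ts', NormalForm R t) ∧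
      ReflTransGen (IRew R) (app f ts') u := by
  generalize hs : app f ts = s at h
  induction h using ReflTransGen.head_induction_on generalizing f ts with
  | refl =>
    subst hs
    exact ⟨ts, forall₂_refl ts, fun t ht => hu.arg ht, .refl⟩
  | @head s s' hss' h ih =>
    cases hss' with
    | root hlr hn =>
      refine ⟨ts, forall₂_refl ts, fun t ht => hn t (hs ▸ .head ht), ?_⟩
      rw [hs]
      exact .head (.root hlr hn) h
    | congr hab =>
      cases hs
      obtain ⟨ts', hts, hn, htu⟩ := ih rfl
      exact ⟨ts', forall₂_trans (forall₂_append_cons hab _ _) hts, hn, htu⟩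

/-- An innermost reduction of an instance of a linear term to a normal form can first
normalize the substitution. -/
theorem exists_iRews_subst {σ : V → Term F V} (t : Term F V) {u : Term F V}
    (ht : t.Linear) (h : ReflTransGen (IRew R) (t.subst σ) u) (hu : NormalForm R u) :
    ∃ τ : V → Term F V,
      (∀ x ∈ t.varOccs, ReflTransGen (IRew R) (σ x) (τ x) ∧ NormalForm R (τ x)) ∧
      ReflTransGen (IRew R) (t.subst τ) u := by
  classical
  induction t using Term.ind generalizing u with
  | hvar x =>
    rw [subst_var] at h
    refine ⟨fun _ => u, fun y hy => ?_, by rw [subst_var]⟩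
    rw [mem_varOccs_var.1 hy]
    exact ⟨h, hu⟩
  | happ f ts ih =>
    rw [subst_app] at h
    obtain ⟨us, hus, hn, hu'⟩ := exists_iRews_args h hu
    suffices ∃ τ : V → Term F V,
        (∀ x ∈ ts.flatMap varOccs, ReflTransGen (IRew R) (σ x) (τ x) ∧ NormalForm R (τ x)) ∧
        Forall₂ (ReflTransGen (IRew R)) (ts.map (subst τ)) us by
      obtain ⟨τ, hτ, hτus⟩ := this
      refine ⟨τ, by rwa [varOccs_app], ?_⟩
      rw [subst_app]
      exact (iRews_of_forall₂ hτus).trans hu'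
    rw [Linear, varOccs_app] at ht
    clear h hu hu'
    induction ts generalizing us with
    | nil => exact ⟨σ, by simp, by simpa using hus⟩
    | cons t ts ihts =>
      rw [List.map_cons, List.forall₂_cons_left_iff] at hus
      obtain ⟨u, us, htu, htsus, rfl⟩ := hus
      rw [List.forall_mem_cons] at hn
      rw [List.flatMap_cons, List.nodup_append'] at ht
      obtain ⟨τ₁, h₁, h₁'⟩ := ih t (by simp) ht.1 htu hn.1
      obtain ⟨τ₂, h₂, h₂'⟩ := ihts (fun t ht => ih t (by simp [ht])) ht.2.1 us htsus hn.2
      refine ⟨fun x => if x ∈ t.varOccs then τ₁ x else τ₂ x, fun x hx => ?_, ?_⟩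
      · by_cases hxt : x ∈ t.varOccs
        · simpa [hxt] using h₁ x hxt
        · rw [List.flatMap_cons, List.mem_append] at hx
          simpa [hxt] using h₂ x (hx.resolve_left hxt)
      · rw [List.map_cons]
        refine .cons ?_ ?_
        · rwa [Term.subst_congr (τ := τ₁) t fun x hx => if_pos hx]
        · rwa [List.map_congr_left (g := subst τ₂) fun s hs => Term.subst_congr s fun x hx =>
            if_neg fun hxt => ht.2.2 hxt (List.mem_flatMap.2 ⟨s, hs, hx⟩)]

theorem iRews_of_rew (hR : IsTRS R) (hRL : RightLinear R) (hOV : Overlay (R ∪ P))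
    {s t u : Term F V} (hst : Rew R s t) (hs : Terminating R s)
    (htu : ReflTransGen (IRew R) t u) (hu : NormalForm R u) :
    ReflTransGen (IRew R) s u := by
  classical
  induction hst generalizing u with
  | @root l r σ hlr =>
    obtain ⟨f, ls, rfl⟩ := exists_eq_app (hR _ hlr).1
    obtain ⟨τ, hτ, hτu⟩ := exists_iRews_subst r (hRL _ hlr) htu hu
    choose ν hν hν' using exists_iRews_normalForm R
    set τ' : V → Term F V := fun x => if x ∈ r.varOccs then τ x else ν (σ x) with hτ'
    have hστ : ∀ x ∈ (app f ls).varOccs,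
        ReflTransGen (IRew R) (σ x) (τ' x) ∧ NormalForm R (τ' x) := fun x hx => by
      by_cases hxr : x ∈ r.varOccs
      · simpa [hτ', hxr] using hτ x hxr
      · simpa [hτ', hxr] using ⟨hν (σ x), hν' (σ x) (hs.subst_var_mem hx)⟩
    have hr : r.subst τ = r.subst τ' := Term.subst_congr r fun x hx => by simp [hτ', hx]
    refine (rel_subst (fun _ _ _ => iRews_of_forall₂) (app f ls)
      fun x hx => (hστ x hx).1).trans (.head (.root hlr fun v hv => ?_) (hr ▸ hτu))
    rw [subst_app] at hv
    refine normalForm_of_pSub_app (fun t ht => ?_) hv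
    obtain ⟨a, ha, rfl⟩ := List.mem_map.1 ht
    refine (hOV.noRedexInstance (.inl hlr) ha).normalForm_subst fun x hx => (hστ x ?_).2
    rw [varOccs_app]
    exact List.mem_flatMap.2 ⟨a, ha, hx⟩
  | @congr a b f ps qs hab ih =>
    obtain ⟨us, hus, hn, hu'⟩ := exists_iRews_args htu hu
    refine .trans (iRews_of_forall₂ ?_) hu'
    clear htu hu'
    have ha := hs.arg (t := a) (by simp)
    clear hs
    induction ps generalizing us with
    | nil =>
      rw [List.nil_append, List.forall₂_cons_left_iff] at hus
      obtain ⟨v, vs, hbv, hvs, rfl⟩ := hus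
      exact .cons (ih ha hbv (hn v (by simp))) hvs
    | cons p ps ihps =>
      rw [List.cons_append, List.forall₂_cons_left_iff] at hus
      obtain ⟨v, vs, hpv, hvs, rfl⟩ := hus
      exact .cons hpv (ihps vs hvs fun t ht => hn t (by simp [ht]))

theorem iRews_of_rews (hR : IsTRS R) (hRL : RightLinear R) (hOV : Overlay (R ∪ P))
    {s u : Term F V} (hs : Terminating R s) (hsu : ReflTransGen (Rew R) s u)
    (hu : NormalForm R u) : ReflTransGen (IRew R) s u := by
  induction hsu using ReflTransGen.head_induction_on with
  | refl => exact .refl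
  | head h _ ih => exact iRews_of_rew hR hRL hOV h hs (ih (hs.of_rew h)) hu

end Innermost

/-! ### A deterministic bottom-up normalization function -/

section Normalize

variable {R : Set (Term F V × Term F V)}

open Classical in
/-- Some normal form of `t`, or `t` itself if it has none. -/
noncomputable def someNormalForm (R : Set (Term F V × Term F V)) (t : Term F V) : Term F V :=
  if h : ∃ u, ReflTransGen (Rew R) t u ∧ NormalForm R u then h.choose else t

mutual
/-- Normalization of a term, arguments first. -/
noncomputable def normalize (R : Set (Term F V × Term F V)) : Term F V → Term F V
  | .var x => .var x
  | .app f ts => someNormalForm R (.app f (normalizeList R ts))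

/-- `normalize` on every entry of a list. -/
noncomputable def normalizeList (R : Set (Term F V × Term F V)) :
    List (Term F V) → List (Term F V)
  | [] => []
  | t :: ts => normalize R t :: normalizeList R ts
end

theorem normalizeList_eq_map (ts : List (Term F V)) :
    normalizeList R ts = ts.map (normalize R) := by
  induction ts with
  | nil => rfl
  | cons t ts ih => rw [normalizeList, ih, List.map_cons]

theorem normalize_app (f : F) (ts : List (Term F V)) :
    normalize R (app f ts) = someNormalForm R (app f (ts.map (normalize R))) := by
  rw [normalize, normalizeList_eq_map]

theorem rews_someNormalForm (t : Term F V) :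
    ReflTransGen (Rew R) t (someNormalForm R t) := by
  rw [someNormalForm]
  split_ifs with h
  · exact h.choose_spec.1
  · exact .refl

theorem NormalForm.someNormalForm_eq {t : Term F V} (h : NormalForm R t) :
    someNormalForm R t = t :=
  (h.eq_of_rews (rews_someNormalForm t)).symm

theorem Terminating.normalForm_someNormalForm {t : Term F V} (h : Terminating R t) :
    NormalForm R (someNormalForm R t) := by
  obtain ⟨u, hu, hn⟩ := exists_iRews_normalForm R t
  have hex : ∃ u, ReflTransGen (Rew R) t u ∧ NormalForm R u :=
    ⟨u, ReflTransGen.mono (fun _ _ h => IRew.rew h) _ _ hu, hn h⟩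
  rw [someNormalForm, dif_pos hex]
  exact hex.choose_spec.2

theorem rews_normalize (t : Term F V) : ReflTransGen (Rew R) t (normalize R t) := by
  induction t using Term.ind with
  | hvar x => rw [normalize]
  | happ f ts ih =>
    rw [normalize_app]
    refine .trans (rews_of_forall₂ ?_) (rews_someNormalForm _)
    rw [List.forall₂_map_right_iff, List.forall₂_same]
    exact ih

theorem forall₂_normalize (ts : List (Term F V)) :
    Forall₂ (ReflTransGen (Rew R)) ts (ts.map (normalize R)) := by
  rw [List.forall₂_map_right_iff, List.forall₂_same]
  exact fun t _ => rews_normalize t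

theorem Terminating.normalForm_normalize (hR : IsTRS R) {t : Term F V}
    (h : Terminating R t) : NormalForm R (normalize R t) := by
  cases t with
  | var x =>
    rw [normalize]
    exact fun u => not_rew_var hR
  | app f ts =>
    rw [normalize_app]
    exact (h.of_rews (rews_of_forall₂ (forall₂_normalize ts))).normalForm_someNormalForm

theorem NoRedexInstance.normalize_subst (hR : IsTRS R) {σ : V → Term F V} {u : Term F V}
    (h : NoRedexInstance R u) (hσ : Terminating R (u.subst σ)) :
    normalize R (u.subst σ) = u.subst fun x => normalize R (σ x) := by
  induction u using Term.ind with
  | hvar x => rw [subst_var, subst_var]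
  | happ f us ih =>
    have hn : NormalForm R ((app f us).subst fun x => normalize R (σ x)) :=
      h.normalForm_subst fun x hx => (hσ.subst_var_mem hx).normalForm_normalize hR
    rw [subst_app] at hσ hn ⊢
    rw [subst_app, normalize_app, List.map_map]
    have hus : us.map (normalize R ∘ subst σ) = us.map (subst fun x => normalize R (σ x)) :=
      List.map_congr_left fun u hu => ih u hu (h.arg hu) (hσ.arg (List.mem_map_of_mem hu))
    rw [hus, hn.someNormalForm_eq]

end Normalize

/-! ### Normalizing the frozen positions

Fix a property `K` of terms, to be thought of as `K u ↔ C[u]` starts an infinite chain, for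
a context `C` surrounding `t`. A position of `t` is frozen if no rewrite step at or below it
preserves `K`. -/

section Frozen

variable {R : Set (Term F V × Term F V)}

/-- No rewrite step from `t` leads into `K`. -/
def Frozen (R : Set (Term F V × Term F V)) (K : Term F V → Prop) (t : Term F V) : Prop :=
  ∀ u, Rew R t u → ¬ K u

open Classical in
mutual
/-- Normalize all maximal frozen subterm occurrences. -/
noncomputable def normalizeFrozen (R : Set (Term F V × Term F V)) :
    (Term F V → Prop) → Term F V → Term F V
  | _, .var x => .var x
  | K, .app f ts =>
    if Frozen R K (.app f ts) then normalize R (.app f ts)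
    else .app f (normalizeFrozenList R (fun us => K (.app f us)) ts)

/-- `normalizeFrozen` on every entry of a list, with respect to a property of lists. -/
noncomputable def normalizeFrozenList (R : Set (Term F V × Term F V)) :
    (List (Term F V) → Prop) → List (Term F V) → List (Term F V)
  | _, [] => []
  | K, t :: ts =>
    normalizeFrozen R (fun u => K (u :: ts)) t ::
      normalizeFrozenList R (fun us => K (t :: us)) ts
end

theorem normalizeFrozen_app_of_frozen {K : Term F V → Prop} {f : F} {ts : List (Term F V)}
    (h : Frozen R K (app f ts)) :
    normalizeFrozen R K (app f ts) = normalize R (app f ts) := by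
  rw [normalizeFrozen, if_pos h]

theorem normalizeFrozen_app_of_not_frozen {K : Term F V → Prop} {f : F}
    {ts : List (Term F V)} (h : ¬ Frozen R K (app f ts)) :
    normalizeFrozen R K (app f ts) =
      app f (normalizeFrozenList R (fun us => K (app f us)) ts) := by
  rw [normalizeFrozen, if_neg h]

theorem normalizeFrozen_of_frozen {K : Term F V → Prop} {t : Term F V} (h : Frozen R K t) :
    normalizeFrozen R K t = normalize R t := by
  cases t with
  | var x => rw [normalizeFrozen, normalize]
  | app f ts => exact normalizeFrozen_app_of_frozen h

theorem normalizeFrozenList_of_frozen {K : List (Term F V) → Prop} {ts : List (Term F V)}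
    (h : ∀ us, ListRew R ts us → ¬ K us) :
    normalizeFrozenList R K ts = ts.map (normalize R) := by
  induction ts generalizing K with
  | nil => rw [normalizeFrozenList, List.map_nil]
  | cons t ts ih =>
    rw [normalizeFrozenList, List.map_cons,
      normalizeFrozen_of_frozen fun u hu => h _ (.head hu), ih fun us hus => h _ (.tail hus)]

theorem Frozen.of_listRew {K : Term F V → Prop} {f : F} {ts : List (Term F V)}
    (h : Frozen R K (app f ts)) {us : List (Term F V)} (hus : ListRew R ts us) :
    ¬ K (app f us) :=
  h _ (hus.belowRew f).rew

mutual
theorem rews_normalizeFrozen (K : Term F V → Prop) :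
    ∀ t : Term F V, ReflTransGen (Rew R) t (normalizeFrozen R K t)
  | .var x => by rw [normalizeFrozen]
  | .app f ts => by
    by_cases h : Frozen R K (app f ts)
    · rw [normalizeFrozen_of_frozen h]
      exact rews_normalize _
    · rw [normalizeFrozen_app_of_not_frozen h]
      exact rews_of_forall₂ (forall₂_normalizeFrozen _ ts)

theorem forall₂_normalizeFrozen (K : List (Term F V) → Prop) :
    ∀ ts : List (Term F V), Forall₂ (ReflTransGen (Rew R)) ts (normalizeFrozenList R K ts)
  | [] => .nil
  | t :: ts => by
    rw [normalizeFrozenList]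
    exact .cons (rews_normalizeFrozen _ t) (forall₂_normalizeFrozen _ ts)
end

mutual
theorem normalizeFrozen_rews_normalize (K : Term F V → Prop) :
    ∀ t : Term F V, ReflTransGen (Rew R) (normalizeFrozen R K t) (normalize R t)
  | .var x => by rw [normalizeFrozen, normalize]
  | .app f ts => by
    by_cases h : Frozen R K (app f ts)
    · rw [normalizeFrozen_of_frozen h]
    · rw [normalizeFrozen_app_of_not_frozen h, normalize_app]
      exact (rews_of_forall₂ (forall₂_normalizeFrozen_normalize _ ts)).trans
        (rews_someNormalForm _)

theorem forall₂_normalizeFrozen_normalize (K : List (Term F V) → Prop) :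
    ∀ ts : List (Term F V),
      Forall₂ (ReflTransGen (Rew R)) (normalizeFrozenList R K ts) (ts.map (normalize R))
  | [] => .nil
  | t :: ts => by
    rw [normalizeFrozenList, List.map_cons]
    exact .cons (normalizeFrozen_rews_normalize _ t) (forall₂_normalizeFrozen_normalize _ ts)
end

theorem app_normalizeFrozenList_rews (K : Term F V → Prop) (f : F) (ts : List (Term F V)) :
    ReflTransGen (Rew R) (app f (normalizeFrozenList R (fun us => K (app f us)) ts))
      (normalizeFrozen R K (app f ts)) := by
  by_cases h : Frozen R K (app f ts)
  · rw [normalizeFrozen_of_frozen h, normalize_app]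
    exact (rews_of_forall₂ (forall₂_normalizeFrozen_normalize _ _)).trans
      (rews_someNormalForm _)
  · rw [normalizeFrozen_app_of_not_frozen h]

mutual
/-- Shrinking `K` on the reducts of `t` freezes more positions. -/
theorem normalizeFrozen_mono {K K' : Term F V → Prop} :
    ∀ t : Term F V, (∀ u, ReflTransGen (Rew R) t u → K' u → K u) →
      ReflTransGen (Rew R) (normalizeFrozen R K t) (normalizeFrozen R K' t)
  | .var x, _ => by rw [normalizeFrozen, normalizeFrozen]
  | .app f ts, h => by
    by_cases hK' : Frozen R K' (app f ts)
    · rw [normalizeFrozen_of_frozen hK']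
      exact normalizeFrozen_rews_normalize _ _
    have hK : ¬ Frozen R K (app f ts) := fun hK =>
      hK' fun u hu hu' => hK u hu (h u (.single hu) hu')
    rw [normalizeFrozen_app_of_not_frozen hK, normalizeFrozen_app_of_not_frozen hK']
    exact rews_of_forall₂ (normalizeFrozenList_mono ts fun us hus => h _ (rews_of_forall₂ hus))

theorem normalizeFrozenList_mono {K K' : List (Term F V) → Prop} :
    ∀ ts : List (Term F V),
      (∀ us, Forall₂ (ReflTransGen (Rew R)) ts us → K' us → K us) →
      Forall₂ (ReflTransGen (Rew R)) (normalizeFrozenList R K ts) (normalizeFrozenList R K' ts)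
  | [], _ => .nil
  | t :: ts, h => by
    rw [normalizeFrozenList, normalizeFrozenList]
    exact .cons (normalizeFrozen_mono t fun u hu => h _ (.cons hu (forall₂_refl ts)))
      (normalizeFrozenList_mono ts fun us hus => h _ (.cons .refl hus))
end

mutual
/-- The instance of a left-hand side part `u` with its frozen positions normalized rewrites to
the instance of `u` under the substitution normalized at the positions frozen with respect
to `L`, provided `L` is at least as restrictive as `K`. -/
theorem normalizeFrozen_subst_rews [DecidableEq V] (hR : IsTRS R) {ρ : V → Term F V}
    {L : V → Term F V → Prop} {K : Term F V → Prop} :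
    ∀ u : Term F V, NoRedexInstance R u → Terminating R (u.subst ρ) →
      (∀ y v w, ReflTransGen (Rew R) (ρ y) v → L y v →
        ReflTransGen (Rew R) w (u.subst (Function.update ρ y v)) → K w) →
      ReflTransGen (Rew R) (normalizeFrozen R K (u.subst ρ))
        (u.subst fun y => normalizeFrozen R (L y) (ρ y))
  | .var x, _, _, hK => by
    rw [subst_var, subst_var]
    exact normalizeFrozen_mono _ fun v hv hLv =>
      hK x v v hv hLv (by rw [subst_var, Function.update_self])
  | .app f us, hu, hT, hK => by
    have hfrozen : normalizeFrozen R K ((app f us).subst ρ) =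
        app f (normalizeFrozenList R (fun ws => K (app f ws)) (us.map (subst ρ))) := by
      by_cases h : Frozen R K ((app f us).subst ρ)
      · rw [normalizeFrozen_of_frozen h, hu.normalize_subst hR hT, subst_app]
        rw [subst_app] at h hT
        rw [normalizeFrozenList_of_frozen fun _ => h.of_listRew, List.map_map]
        congr 1
        exact List.map_congr_left fun u hu' => ((hu.arg hu').normalize_subst hR
          (hT.arg (List.mem_map_of_mem hu'))).symm
      · rw [subst_app] at h ⊢
        exact normalizeFrozen_app_of_not_frozen h
    rw [hfrozen, subst_app]
    rw [subst_app] at hT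
    refine rews_of_forall₂ (normalizeFrozenList_subst_rews hR us (fun u => hu.arg)
      (fun u hu' => hT.arg (List.mem_map_of_mem hu')) fun y v ws hv hL hws =>
        hK y v _ hv hL ?_)
    rw [subst_app]
    exact rews_of_forall₂ hws

theorem normalizeFrozenList_subst_rews [DecidableEq V] (hR : IsTRS R) {ρ : V → Term F V}
    {L : V → Term F V → Prop} {K : List (Term F V) → Prop} :
    ∀ us : List (Term F V), (∀ u ∈ us, NoRedexInstance R u) →
      (∀ u ∈ us, Terminating R (u.subst ρ)) →
      (∀ y v ws, ReflTransGen (Rew R) (ρ y) v → L y v →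
        Forall₂ (ReflTransGen (Rew R)) ws (us.map (subst (Function.update ρ y v))) → K ws) →
      Forall₂ (ReflTransGen (Rew R)) (normalizeFrozenList R K (us.map (subst ρ)))
        (us.map (subst fun y => normalizeFrozen R (L y) (ρ y)))
  | [], _, _, _ => .nil
  | u :: us, hu, hT, hK => by
    rw [List.forall_mem_cons] at hu hT
    rw [List.map_cons, List.map_cons, normalizeFrozenList]
    exact .cons
      (normalizeFrozen_subst_rews hR u hu.1 hT.1 fun y v w hv hL hw => hK y v _ hv hL
        (.cons hw (rews_subst_map us (rews_update hv))))
      (normalizeFrozenList_subst_rews hR us hu.2 hT.2 fun y v ws hv hL hws => hK y v _ hv hL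
        (.cons (rews_subst u (rews_update hv)) hws))
end

mutual
/-- The instance of a linear right-hand side part `u` under the substitution normalized at the
positions frozen with respect to `L` rewrites to the instance of `u` with its frozen positions
normalized, provided `K` is at least as restrictive as `L`. -/
theorem subst_rews_normalizeFrozen [DecidableEq V] {ρ : V → Term F V}
    {L : V → Term F V → Prop} {K : Term F V → Prop} :
    ∀ u : Term F V, u.Linear →
      (∀ y ∈ u.varOccs, ∀ v, K (u.subst (Function.update ρ y v)) → L y v) →
      ReflTransGen (Rew R) (u.subst fun y => normalizeFrozen R (L y) (ρ y))
        (normalizeFrozen R K (u.subst ρ))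
  | .var x, _, hK => by
    rw [subst_var, subst_var]
    exact normalizeFrozen_mono _ fun v _ hKv =>
      hK x (mem_varOccs_var.2 rfl) v (by rwa [subst_var, Function.update_self])
  | .app f us, hu, hK => by
    rw [Linear, varOccs_app] at hu
    rw [varOccs_app] at hK
    rw [subst_app, subst_app]
    refine .trans (rews_of_forall₂ (subst_rews_normalizeFrozenList us hu fun y hy v hKv =>
      hK y hy v ?_)) (app_normalizeFrozenList_rews K f (us.map (subst ρ)))
    rwa [subst_app]

theorem subst_rews_normalizeFrozenList [DecidableEq V] {ρ : V → Term F V}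
    {L : V → Term F V → Prop} {K : List (Term F V) → Prop} :
    ∀ us : List (Term F V), (us.flatMap varOccs).Nodup →
      (∀ y ∈ us.flatMap varOccs, ∀ v, K (us.map (subst (Function.update ρ y v))) → L y v) →
      Forall₂ (ReflTransGen (Rew R)) (us.map (subst fun y => normalizeFrozen R (L y) (ρ y)))
        (normalizeFrozenList R K (us.map (subst ρ)))
  | [], _, _ => .nil
  | u :: us, hu, hK => by
    rw [List.flatMap_cons, List.nodup_append'] at hu
    rw [List.flatMap_cons] at hK
    rw [List.map_cons, List.map_cons, normalizeFrozenList]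
    refine .cons
      (subst_rews_normalizeFrozen u hu.1 fun y hy v hKv =>
        hK y (List.mem_append_left _ hy) v ?_)
      (subst_rews_normalizeFrozenList us hu.2.1 fun y hy v hKv =>
        hK y (List.mem_append_right _ hy) v ?_)
    · rwa [List.map_cons, List.map_congr_left (g := subst ρ) fun s hs =>
        Term.subst_congr s fun x hx => Function.update_of_ne (fun hxy : x = y => hu.2.2 hy
          (List.mem_flatMap.2 ⟨s, hs, hxy ▸ hx⟩)) _ _]
    · rwa [List.map_cons, Term.subst_congr (τ := ρ) u fun x hx =>
        Function.update_of_ne (fun hxy : x = y => hu.2.2 (hxy ▸ hx) hy) _ _]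
end

theorem normalizeFrozenList_rews_append {s t : Term F V} (hst : Rew R s t)
    (h : ∀ K : Term F V → Prop, (∀ u v, ReflTransGen (Rew R) u v → K v → K u) → K t →
      ReflTransGen (Rew R) (normalizeFrozen R K s) (normalizeFrozen R K t))
    {K : List (Term F V) → Prop}
    (hK : ∀ us vs, Forall₂ (ReflTransGen (Rew R)) us vs → K vs → K us)
    (ps qs : List (Term F V)) (hKt : K (ps ++ t :: qs)) :
    Forall₂ (ReflTransGen (Rew R)) (normalizeFrozenList R K (ps ++ s :: qs))
      (normalizeFrozenList R K (ps ++ t :: qs)) := by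
  induction ps generalizing K with
  | nil =>
    rw [List.nil_append, List.nil_append, normalizeFrozenList, normalizeFrozenList]
    exact .cons (h _ (fun u v huv => hK _ _ (.cons huv (forall₂_refl qs))) hKt)
      (normalizeFrozenList_mono qs fun us _ => hK _ _ (.cons (.single hst) (forall₂_refl us)))
  | cons p ps ih =>
    rw [List.cons_append, List.cons_append, normalizeFrozenList, normalizeFrozenList]
    exact .cons
      (normalizeFrozen_mono p fun u _ => hK _ _ (.cons .refl (forall₂_append_cons hst ps qs)))
      (ih (fun us vs h => hK _ _ (.cons .refl h)) hKt)

/-- Normalizing frozen positions is compatible with rewrite steps inside `K`. -/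
theorem normalizeFrozen_rews_of_rew {P : Set (Term F V × Term F V)} (hR : IsTRS R)
    (hRL : RightLinear R) (hOV : Overlay (R ∪ P)) {s t : Term F V} (hst : Rew R s t)
    (hs : Terminating R s) {K : Term F V → Prop}
    (hK : ∀ u v, ReflTransGen (Rew R) u v → K v → K u) (hKt : K t) :
    ReflTransGen (Rew R) (normalizeFrozen R K s) (normalizeFrozen R K t) := by
  classical
  induction hst generalizing K with
  | @root l r ρ hlr =>
    obtain ⟨f, ls, rfl⟩ := exists_eq_app (hR _ hlr).1
    have hn : ¬ Frozen R K ((app f ls).subst ρ) := fun h => h _ (.root hlr) hKt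
    refine .trans ?_ (subst_rews_normalizeFrozen
      (L := fun y v => K (r.subst (Function.update ρ y v))) r (hRL _ hlr) fun _ _ _ h => h)
    refine .trans ?_ (.single (.root hlr))
    rw [subst_app] at hs hn ⊢
    rw [subst_app, normalizeFrozen_app_of_not_frozen hn]
    refine rews_of_forall₂ (normalizeFrozenList_subst_rews hR ls
      (fun u hu => hOV.noRedexInstance (.inl hlr) hu)
      (fun u hu => hs.arg (List.mem_map_of_mem hu)) fun y v ws _ hL hws => hK _ _ ?_ hL)
    refine .tail (rews_of_forall₂ hws) ?_
    rw [← subst_app]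
    exact .root hlr
  | @congr a b f ps qs hab ih =>
    have hn : ¬ Frozen R K (app f (ps ++ a :: qs)) := fun h => h _ (.congr hab) hKt
    rw [normalizeFrozen_app_of_not_frozen hn]
    exact (rews_of_forall₂ (normalizeFrozenList_rews_append hab
      (fun K => ih (hs.arg (by simp))) (fun us vs h => hK _ _ (rews_of_forall₂ h)) ps qs
      hKt)).trans (app_normalizeFrozenList_rews K f _)

end Frozen

/-! ### Infinite minimal chains -/

section Chains

variable {P R : Set (Term F V × Term F V)}

/-- `t` starts an infinite minimal `(P,R)`-chain, defined coinductively. -/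
def StartsMinChain (P R : Set (Term F V × Term F V)) (t : Term F V) : Prop :=
  ∃ X : Term F V → Prop, X t ∧ ∀ t, X t → ArgsTerminating R t ∧
    ∃ s t', ReflTransGen (BelowRew R) t s ∧ RootStep P s t' ∧ X t'

/-- `t` starts an infinite `(P,R)`-chain that is minimal from the second term on. -/
def ReachesMinChain (P R : Set (Term F V × Term F V)) (t : Term F V) : Prop :=
  ∃ s t', ReflTransGen (BelowRew R) t s ∧ RootStep P s t' ∧ StartsMinChain P R t'

theorem startsMinChain_iff {t : Term F V} :
    StartsMinChain P R t ↔ ArgsTerminating R t ∧ ReachesMinChain P R t := by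
  constructor
  · rintro ⟨X, ht, hX⟩
    obtain ⟨hat, s, t', hts, hst, ht'⟩ := hX t ht
    exact ⟨hat, s, t', hts, hst, X, ht', hX⟩
  · rintro ⟨hat, s, t', hts, hst, X, ht', hX⟩
    refine ⟨fun u => u = t ∨ X u, .inl rfl, ?_⟩
    rintro u (rfl | hu)
    · exact ⟨hat, s, t', hts, hst, .inr ht'⟩
    · obtain ⟨hau, s, u', hus, hsu, hu'⟩ := hX u hu
      exact ⟨hau, s, u', hus, hsu, .inr hu'⟩

theorem ReachesMinChain.of_belowRews {s t : Term F V} (h : ReachesMinChain P R t)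
    (hst : ReflTransGen (BelowRew R) s t) : ReachesMinChain P R s := by
  obtain ⟨u, t', htu, hut, ht'⟩ := h
  exact ⟨u, t', hst.trans htu, hut, ht'⟩

theorem ReachesMinChain.of_forall₂ {f : F} {ts us : List (Term F V)}
    (h : Forall₂ (ReflTransGen (Rew R)) ts us) (hus : ReachesMinChain P R (app f us)) :
    ReachesMinChain P R (app f ts) :=
  hus.of_belowRews (belowRews_of_forall₂ h)

/-- Normalize the argument positions of `t` that are frozen with respect to starting an
infinite chain. -/
noncomputable def normalizeFrozenArgs (P R : Set (Term F V × Term F V)) :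
    Term F V → Term F V
  | .var x => .var x
  | .app f ts => .app f (normalizeFrozenList R (fun us => ReachesMinChain P R (.app f us)) ts)

theorem belowRews_normalizeFrozenArgs (t : Term F V) :
    ReflTransGen (BelowRew R) t (normalizeFrozenArgs P R t) := by
  cases t with
  | var x => exact .refl
  | app f ts => exact belowRews_of_forall₂ (forall₂_normalizeFrozen _ ts)

theorem normalizeFrozenArgs_belowRews (hR : IsTRS R) (hRL : RightLinear R)
    (hOV : Overlay (R ∪ P)) {s t : Term F V} (hst : ReflTransGen (BelowRew R) s t)
    (hs : ArgsTerminating R s) (ht : ReachesMinChain P R t) :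
    ReflTransGen (BelowRew R) (normalizeFrozenArgs P R s) (normalizeFrozenArgs P R t) := by
  induction hst using ReflTransGen.head_induction_on with
  | refl => exact .refl
  | @head s s' hss' hst ih =>
    refine .trans ?_ (ih (hs.of_belowRews (.single hss')))
    obtain ⟨f, ps, qs, a, b, hab, rfl, rfl⟩ := hss'
    exact belowRews_of_forall₂ (normalizeFrozenList_rews_append hab
      (fun K => normalizeFrozen_rews_of_rew hR hRL hOV hab
        (argsTerminating_app.1 hs a (by simp)))
      (fun _ _ => ReachesMinChain.of_forall₂) ps qs (ht.of_belowRews hst))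

theorem exists_rootStep_normalizeFrozenArgs (hR : IsTRS R) (hP : IsTRS P)
    (hnc : NonCollapsing P) (hPL : RightLinear P) (hOV : Overlay (R ∪ P)) {s t : Term F V}
    (hst : RootStep P s t) (hs : ArgsTerminating R s) (ht : StartsMinChain P R t) :
    ∃ u v, ReflTransGen (BelowRew R) (normalizeFrozenArgs P R s) u ∧ RootStep P u v ∧
      ArgsTerminating R v ∧ ReflTransGen (BelowRew R) v (normalizeFrozenArgs P R t) := by
  classical
  obtain ⟨l, r, ρ, hlr, rfl, rfl⟩ := hst
  obtain ⟨f, ls, rfl⟩ := exists_eq_app (hP _ hlr).1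
  obtain ⟨g, rs, rfl⟩ := exists_eq_app (hnc _ hlr)
  let L : V → Term F V → Prop := fun y v =>
    ReachesMinChain P R ((app g rs).subst (Function.update ρ y v))
  have hat := (startsMinChain_iff.1 ht).1
  refine ⟨(app f ls).subst fun y => normalizeFrozen R (L y) (ρ y), _, ?_,
    ⟨_, _, _, hlr, rfl, rfl⟩, ?_, ?_⟩
  · rw [subst_app] at hs ⊢
    rw [subst_app]
    refine belowRews_of_forall₂ (normalizeFrozenList_subst_rews hR ls
      (fun u hu => hOV.noRedexInstance (.inr hlr) hu)
      (fun u hu => argsTerminating_app.1 hs _ (List.mem_map_of_mem hu))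
      fun y v ws hv hL hws => ?_)
    refine ⟨(app f ls).subst (Function.update ρ y v), _, ?_, ⟨_, _, _, hlr, rfl, rfl⟩,
      startsMinChain_iff.2 ⟨hat.of_belowRews ?_, hL⟩⟩
    · rw [subst_app]
      exact belowRews_of_forall₂ hws
    · rw [subst_app, subst_app]
      exact belowRews_of_forall₂ (rews_subst_map rs (rews_update hv))
  · rw [subst_app] at hat ⊢
    exact hat.of_belowRews (belowRews_of_forall₂
      (rews_subst_map rs fun y => rews_normalizeFrozen (L y) (ρ y)))
  · have hlin := hPL _ hlr
    rw [Linear, varOccs_app] at hlin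
    rw [subst_app, subst_app]
    refine belowRews_of_forall₂ (subst_rews_normalizeFrozenList rs hlin fun y _ v h => ?_)
    rw [← subst_app] at h
    exact h

theorem StartsMinChain.normalizeFrozenArgs (hR : IsTRS R) (hP : IsTRS P)
    (hnc : NonCollapsing P) (hRL : RightLinear (R ∪ P)) (hOV : Overlay (R ∪ P)) {t : Term F V}
    (ht : StartsMinChain P R t) : StartsMinChain P R (normalizeFrozenArgs P R t) := by
  refine ⟨fun u => ∃ t, StartsMinChain P R t ∧ ArgsTerminating R u ∧
    ReflTransGen (BelowRew R) u (RWS.normalizeFrozenArgs P R t), ⟨t, ht, ?_, .refl⟩, ?_⟩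
  · exact (startsMinChain_iff.1 ht).1.of_belowRews (belowRews_normalizeFrozenArgs t)
  · rintro u ⟨t, ht, hau, hut⟩
    obtain ⟨hat, s, t', hts, hst, ht'⟩ := startsMinChain_iff.1 ht
    obtain ⟨v, v', hsv, hvv', hav', hvt⟩ := exists_rootStep_normalizeFrozenArgs hR hP hnc
      (fun p hp => hRL p (.inr hp)) hOV hst (hat.of_belowRews hts) ht'
    exact ⟨hau, v, v', (hut.trans (normalizeFrozenArgs_belowRews hR
      (fun p hp => hRL p (.inl hp)) hOV hts hat ⟨s, t', .refl, hst, ht'⟩)).trans hsv, hvv',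
      t', ht', hav', hvt⟩

theorem exists_reachesMinChain_frozen {f : F} {ts : List (Term F V)}
    (hts : ∀ t ∈ ts, Terminating R t) (h : ReachesMinChain P R (app f ts)) :
    ∃ us, ReflTransGen (BelowRew R) (app f ts) (app f us) ∧ ReachesMinChain P R (app f us) ∧
      ∀ vs, ListRew R us vs → ¬ ReachesMinChain P R (app f vs) := by
  have hacc := acc_listRew fun t ht => (hts t ht).acc
  clear hts
  induction hacc with
  | intro ts _ ih =>
    by_cases hvs : ∃ vs, ListRew R ts vs ∧ ReachesMinChain P R (app f vs)
    · obtain ⟨vs, htv, hv⟩ := hvs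
      obtain ⟨us, hvu, hu⟩ := ih vs htv hv
      exact ⟨us, .head (htv.belowRew f) hvu, hu⟩
    · exact ⟨ts, .refl, h, fun vs htv hv => hvs ⟨vs, htv, hv⟩⟩

theorem StartsMinChain.exists_app (hP : IsTRS P) {t : Term F V} (h : StartsMinChain P R t) :
    ∃ f ts, t = app f ts := by
  obtain ⟨-, s, t', hts, ⟨l, r, σ, hlr, rfl, rfl⟩, -⟩ := startsMinChain_iff.1 h
  rcases hts.cases_head with rfl | ⟨u, ⟨f, ps, qs, a, b, -, rfl, -⟩, -⟩
  · obtain ⟨f, ls, rfl⟩ := exists_eq_app (hP _ hlr).1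
    exact ⟨f, _, subst_app σ f ls⟩
  · exact ⟨f, _, rfl⟩

/-- An infinite minimal chain can be made to start with normalized arguments. -/
theorem StartsMinChain.exists_normalForm_args (hR : IsTRS R) (hP : IsTRS P)
    (hnc : NonCollapsing P) (hRL : RightLinear (R ∪ P)) (hOV : Overlay (R ∪ P))
    {f : F} {ts : List (Term F V)} (h : StartsMinChain P R (app f ts)) :
    ∃ us, Forall₂ (ReflTransGen (Rew R)) ts us ∧ (∀ u ∈ us, NormalForm R u) ∧
      StartsMinChain P R (app f us) := by
  obtain ⟨hat, hr⟩ := startsMinChain_iff.1 h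
  obtain ⟨us, htu, hus, hfrozen⟩ :=
    exists_reachesMinChain_frozen (argsTerminating_app.1 hat) hr
  have hau := hat.of_belowRews htu
  have hnorm := (startsMinChain_iff.2 ⟨hau, hus⟩).normalizeFrozenArgs hR hP hnc hRL hOV
  rw [RWS.normalizeFrozenArgs, normalizeFrozenList_of_frozen hfrozen] at hnorm
  obtain ⟨_, ⟨⟩, htus⟩ := forall₂_of_belowRews htu
  refine ⟨_, forall₂_trans htus (forall₂_normalize us), ?_, hnorm⟩
  rw [List.forall_mem_map]
  exact fun u hu => (argsTerminating_app.1 hau u hu).normalForm_normalize hR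

theorem forall₂_iRews_of_forall₂_rews (hR : IsTRS R) (hRL : RightLinear R)
    (hOV : Overlay (R ∪ P)) {ts us : List (Term F V)}
    (h : Forall₂ (ReflTransGen (Rew R)) ts us) (hts : ∀ t ∈ ts, Terminating R t)
    (hus : ∀ u ∈ us, NormalForm R u) : Forall₂ (ReflTransGen (IRew R)) ts us := by
  induction h with
  | nil => exact .nil
  | cons h _ ih =>
    rw [List.forall_mem_cons] at hts hus
    exact .cons (iRews_of_rews hR hRL hOV hts.1 h hus.1) (ih hts.2 hus.2)

theorem StartsMinChain.exists_innermost_step (hR : IsTRS R) (hP : IsTRS P)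
    (hnc : NonCollapsing P) (hRL : RightLinear (R ∪ P)) (hOV : Overlay (R ∪ P)) {t : Term F V}
    (h : StartsMinChain P R t) :
    ∃ s t', ReflTransGen (IBelowRew R) t s ∧ (∀ v, PSub v s → NormalForm R v) ∧
      RootStep P s t' ∧ StartsMinChain P R t' := by
  obtain ⟨f, ts, rfl⟩ := h.exists_app hP
  obtain ⟨us, htu, hn, hu⟩ := h.exists_normalForm_args hR hP hnc hRL hOV
  obtain ⟨-, s, t', hus, hst, ht'⟩ := startsMinChain_iff.1 hu
  obtain ⟨vs, rfl, huv⟩ := forall₂_of_belowRews hus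
  obtain rfl : us = vs := by
    clear hu hus hst htu
    induction huv with
    | nil => rfl
    | cons huv _ ih =>
      rw [List.forall_mem_cons] at hn
      rw [hn.1.eq_of_rews huv, ih hn.2]
  refine ⟨_, t', iBelowRews_of_forall₂ ?_, fun v => normalForm_of_pSub_app hn, hst, ht'⟩
  exact forall₂_iRews_of_forall₂_rews hR (fun p hp => hRL p (.inl hp)) hOV htu
    (argsTerminating_app.1 (startsMinChain_iff.1 h).1) hn

theorem InfMinChain.exists_startsMinChain (h : InfMinChain P R) :
    ∃ t, StartsMinChain P R t := by
  obtain ⟨t, s, hts, hst, ht⟩ := h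
  refine ⟨t 0, fun u => ∃ i, u = t i, ⟨0, rfl⟩, ?_⟩
  rintro _ ⟨i, rfl⟩
  exact ⟨argsTerminating_iff.2 (ht i), s i, t (i + 1), hts i, hst i, i + 1, rfl⟩

theorem InfInnMinChain.infMinChain (h : InfInnMinChain P R) : InfMinChain P R := by
  obtain ⟨t, s, hts, -, hst, ht⟩ := h
  exact ⟨t, s, fun i => ReflTransGen.mono (fun _ _ h => IBelowRew.belowRew h) _ _ (hts i),
    hst, ht⟩

theorem StartsMinChain.infInnMinChain (hR : IsTRS R) (hP : IsTRS P)
    (hnc : NonCollapsing P) (hRL : RightLinear (R ∪ P)) (hOV : Overlay (R ∪ P)) {t : Term F V}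
    (h : StartsMinChain P R t) : InfInnMinChain P R := by
  choose! s t' hts hs hst ht' using
    fun t (h : StartsMinChain P R t) => h.exists_innermost_step hR hP hnc hRL hOV
  have hstarts : ∀ i, StartsMinChain P R (t'^[i] t) := fun i => by
    induction i with
    | zero => exact h
    | succ i ih =>
      rw [Function.iterate_succ_apply']
      exact ht' _ ih
  refine ⟨fun i => t'^[i] t, fun i => s (t'^[i] t), fun i => hts _ (hstarts i),
    fun i => hs _ (hstarts i), fun i => ?_,
    fun i => argsTerminating_iff.1 (startsMinChain_iff.1 (hstarts i)).1⟩
  beta_reduce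
  rw [Function.iterate_succ_apply']
  exact hst _ (hstarts i)

end Chains

end RWS

namespace RWS

/-- Let `R` be a TRS and `P` a non-collapsing TRS such that
`R ∪ P` is a right-linear overlay system. Then there is no infinite minimal
`(P,R)`-chain iff there is no infinite innermost minimal `(P,R)`-chain. -/
theorem no_infinite_minimal_chain_iff_no_infinite_innermost_minimal_chain
    {F V : Type} {R P : Set (Term F V × Term F V)}
    (hR : IsTRS R) (hP : IsTRS P) (hnc : NonCollapsing P)
    (hRL : RightLinear (R ∪ P)) (hOV : Overlay (R ∪ P)) :
    ¬ InfMinChain P R ↔ ¬ InfInnMinChain P R := by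
  refine not_congr ⟨fun h => ?_, InfInnMinChain.infMinChain⟩
  obtain ⟨t, ht⟩ := h.exists_startsMinChain
  exact ht.infInnMinChain hR hP hnc hRL hOV

end RWS
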